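/- Let K be a difference subfield of U with σ(K) = K, and a a finite tuple with σ(a) ∈ K(a)^alg and μ(σ(a)/K(a)) = ld(a/K). Then the sequence ℓ ↦ μ(σ(a)/K(a,σ^ℓ(a))) for ℓ ≥ 1 is nondecreasing: for every ℓ ≥ 1, μ(σ(a)/K(a,σ^ℓ(a))) ≤ μ(σ(a)/K(a,σ^{ℓ+1}(a))). -/

import Mathlib

/- Setting: a large algebraically closed field `U` with an automorphism `σ`.
   Tuples are maps `Fin n → U`; for a tuple `t`, the relevant set of coordinates
   is `Set.range t`.  `fAdj E s` is the subfield `E(s)` generated by a subfield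
   `E` and a set `s`, and `deg E s` is the degree `μ(s/E) = [E(s):E]`. -/

set_option maxHeartbeats 1000000
set_option synthInstance.maxHeartbeats 1000000

open Filter Set

variable {U : Type*}

/-- The subfield `E(s)` generated by the subfield `E` and the set `s`. -/
noncomputable def fAdj [Field U] (E : Subfield U) (s : Set U) : Subfield U :=
  (IntermediateField.adjoin E s).toSubfield

/-- The degree `μ(s/E) = [E(s):E]` (as `Module.finrank`; it is `0` when infinite). -/
noncomputable def deg [Field U] (E : Subfield U) (s : Set U) : ℕ :=
  Module.finrank E (IntermediateField.adjoin E s)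

/-- `k ↦ μ(σ^{k+1}(s) / K(s, σ(s), …, σ^k(s)))`: the sequence whose eventual
value is the limit degree `ld(s/K)`. -/
noncomputable def ldSeq [Field U] (σ : U ≃+* U) (K : Subfield U) (s : Set U) (k : ℕ) : ℕ :=
  deg (fAdj K (⋃ i ∈ Set.Iic k, ⇑(σ ^ i) '' s)) (⇑(σ ^ (k + 1)) '' s)

/-- `k ↦ μ(σ^k(s) / K(s))`: the sequence whose `k`-th roots converge to the
distant degree `dd(s/K)`. -/
noncomputable def ddSeq [Field U] (σ : U ≃+* U) (K : Subfield U) (s : Set U) (k : ℕ) : ℕ :=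
  deg (fAdj K s) (⇑(σ ^ k) '' s)

/-- The inversive closure `K^inv = ⋃ₙ σ^{-n}(K)`. -/
noncomputable def Kinv [Field U] (σ : U ≃+* U) (K : Subfield U) : Subfield U :=
  ⨆ n : ℕ, K.map (σ⁻¹ ^ n : U ≃+* U).toRingHom

/-- The difference field `K(s)_σ = K(σ^i(s) : i ∈ ℕ)` generated by `s` over `K`. -/
noncomputable def diffAdj [Field U] (σ : U ≃+* U) (K : Subfield U) (s : Set U) : Subfield U :=
  fAdj K (⋃ i : ℕ, ⇑(σ ^ i) '' s)

theorem fAdj_eq_sup [Field U] (E : Subfield U) (s : Set U) :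
    fAdj E s = E ⊔ Subfield.closure s := by
  rw [fAdj, IntermediateField.adjoin_toSubfield, Subfield.closure_union]
  congr 1
  have h : Set.range (algebraMap E U) = (E : Set U) := Subtype.range_coe
  rw [h, Subfield.closure_eq]

theorem fAdj_fAdj [Field U] (E : Subfield U) (s t : Set U) :
    fAdj (fAdj E s) t = fAdj E (s ∪ t) := by
  simp only [fAdj_eq_sup, Subfield.closure_union, sup_assoc]

theorem fAdj_mono [Field U] (E : Subfield U) {s t : Set U} (h : s ⊆ t) : fAdj E s ≤ fAdj E t := by
  simp only [fAdj_eq_sup]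
  exact sup_le_sup_left (Subfield.closure_mono h) E

theorem le_fAdj [Field U] (E : Subfield U) (s : Set U) : E ≤ fAdj E s := by
  rw [fAdj_eq_sup]
  exact le_sup_left

theorem map_fAdj [Field U] (σ : U ≃+* U) (E : Subfield U) (s : Set U) :
    (fAdj E s).map σ.toRingHom = fAdj (E.map σ.toRingHom) (σ '' s) := by
  simp only [fAdj_eq_sup, Subfield.map_sup, RingHom.map_field_closure]
  rfl

theorem deg_eq_relfinrank [Field U] (E : Subfield U) (s : Set U) :
    deg E s = E.relfinrank (fAdj E s) := by
  rw [Subfield.relfinrank_eq_finrank_of_le (le_fAdj E s)]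
  rfl

theorem deg_map [Field U] (σ : U ≃+* U) (E : Subfield U) (s : Set U) :
    deg (E.map σ.toRingHom) (σ '' s) = deg E s := by
  rw [deg_eq_relfinrank, deg_eq_relfinrank, ← map_fAdj, Subfield.relfinrank_map_map]

theorem deg_union [Field U] (E : Subfield U) (s t : Set U) :
    deg E (s ∪ t) = deg E s * deg (fAdj E s) t := by
  simp only [deg_eq_relfinrank]
  rw [fAdj_fAdj, Subfield.relfinrank_mul_relfinrank (le_fAdj E s)
    (fAdj_mono E Set.subset_union_left)]

/-- A finite degree does not increase, and stays finite, when the base field is enlarged. -/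
theorem deg_pos_and_le [Field U] {E F : Subfield U} (h : E ≤ F) {s : Set U} (hs : 0 < deg E s) :
    0 < deg F s ∧ deg F s ≤ deg E s := by
  let : Algebra E F := (Subfield.inclusion h).toAlgebra
  have : IsScalarTower E F U := IsScalarTower.of_algebraMap_eq fun _ ↦ rfl
  have : FiniteDimensional E (IntermediateField.adjoin E s) := Module.finite_of_finrank_pos hs
  have hle := IntermediateField.adjoin_rank_le_of_isAlgebraic_right F
    (IntermediateField.adjoin E s)
  have heq : IntermediateField.adjoin F (IntermediateField.adjoin E s : Set U) =
      IntermediateField.adjoin F s := by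
    apply le_antisymm
    · rw [IntermediateField.adjoin_le_iff]
      intro x hx
      have hx' : x ∈ fAdj E s := hx
      change x ∈ fAdj F s
      rw [fAdj_eq_sup] at hx' ⊢
      exact sup_le_sup_right h _ hx'
    · exact IntermediateField.adjoin.mono F _ _ (IntermediateField.subset_adjoin E s)
  rw [heq] at hle
  have hfin : FiniteDimensional F (IntermediateField.adjoin F s) :=
    Module.rank_lt_aleph0_iff.1 (hle.trans_lt (Module.rank_lt_aleph0 _ _))
  refine ⟨Module.finrank_pos, ?_⟩
  exact Cardinal.toNat_le_toNat hle (Module.rank_lt_aleph0 _ _)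

theorem deg_pos_of_le [Field U] {E F : Subfield U} (h : E ≤ F) {s : Set U} (hs : 0 < deg E s) :
    0 < deg F s :=
  (deg_pos_and_le h hs).1

theorem deg_anti [Field U] {E F : Subfield U} (h : E ≤ F) {s : Set U} (hs : 0 < deg E s) :
    deg F s ≤ deg E s :=
  (deg_pos_and_le h hs).2

theorem deg_pos_of_isAlgebraic [Field U] (E : Subfield U) {s : Set U} (hs : s.Finite)
    (h : ∀ x ∈ s, IsAlgebraic E x) : 0 < deg E s := by
  have : Finite s := hs
  have : FiniteDimensional E (IntermediateField.adjoin E s) :=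
    IntermediateField.finiteDimensional_adjoin fun x hx ↦ (h x hx).isIntegral
  exact Module.finrank_pos

theorem image_pow_succ [Field U] (σ : U ≃+* U) (k : ℕ) (s : Set U) :
    ⇑(σ ^ (k + 1)) '' s = σ '' (⇑(σ ^ k) '' s) := by
  rw [pow_succ', Set.image_image]
  rfl

theorem image_biUnion_Iic_subset [Field U] (σ : U ≃+* U) (k : ℕ) (s : Set U) :
    σ '' (⋃ i ∈ Set.Iic k, ⇑(σ ^ i) '' s) ⊆ ⋃ i ∈ Set.Iic (k + 1), ⇑(σ ^ i) '' s := by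
  simp only [Set.image_iUnion, ← image_pow_succ]
  exact Set.iUnion₂_subset fun i hi ↦
    Set.subset_biUnion_of_mem (u := fun i : ℕ ↦ ⇑(σ ^ i) '' s) (Nat.succ_le_succ hi)

/-- If the degree of `σ(s)` over `K(s)` already equals the limit degree, then `σ^{k+1}(s)` has that
degree over every field between `K(σ^k(s))` and `K(s, σ(s), …, σ^k(s))`. -/
theorem deg_eq_limit [Field U] (σ : U ≃+* U) (K : Subfield U) (hK : K.map σ.toRingHom = K)
    (s : Set U) (d : ℕ) (hd : 0 < d) (hlim : ∀ᶠ k in atTop, ldSeq σ K s k = d)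
    (hs : deg (fAdj K s) (σ '' s) = d) (k : ℕ) (E : Subfield U)
    (h₁ : fAdj K (⇑(σ ^ k) '' s) ≤ E) (h₂ : E ≤ fAdj K (⋃ i ∈ Set.Iic k, ⇑(σ ^ i) '' s)) :
    deg E (⇑(σ ^ (k + 1)) '' s) = d := by
  have hshift : ∀ k : ℕ, deg (fAdj K (⇑(σ ^ k) '' s)) (⇑(σ ^ (k + 1)) '' s) = d := by
    intro k
    induction k with
    | zero => simpa using! hs
    | succ k ih =>
      have := deg_map σ (fAdj K (⇑(σ ^ k) '' s)) (⇑(σ ^ (k + 1)) '' s)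
      rwa [map_fAdj, hK, ← image_pow_succ, ← image_pow_succ, ih] at this
  have hldpos : ∀ k, 0 < ldSeq σ K s k := fun k ↦
    deg_pos_of_le (fAdj_mono K (Set.subset_biUnion_of_mem (u := fun i : ℕ ↦ ⇑(σ ^ i) '' s)
      (Set.mem_Iic.2 le_rfl))) ((hshift k).symm ▸ hd)
  have hanti : Antitone (ldSeq σ K s) := by
    refine antitone_nat_of_succ_le fun k ↦ ?_
    have hmap := deg_map σ (fAdj K (⋃ i ∈ Set.Iic k, ⇑(σ ^ i) '' s)) (⇑(σ ^ (k + 1)) '' s)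
    rw [map_fAdj, hK, ← image_pow_succ] at hmap
    have hk := hldpos k
    rw [ldSeq] at hk ⊢
    rw [ldSeq, ← hmap]
    exact deg_anti (fAdj_mono K (image_biUnion_Iic_subset σ k s)) (hmap ▸ hk)
  obtain ⟨N, hN⟩ := eventually_atTop.1 hlim
  have hle : d ≤ ldSeq σ K s k :=
    (hN _ (le_max_right k N)).symm.trans_le (hanti (le_max_left k N))
  refine le_antisymm ((deg_anti h₁ ((hshift k).symm ▸ hd)).trans_eq (hshift k)) (hle.trans ?_)
  exact deg_anti h₂ (deg_pos_of_le h₁ ((hshift k).symm ▸ hd))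

/-- if `σ(a) ∈ K(a)^alg` and `μ(σ(a)/K(a)) = ld(a/K)`, then
`ℓ ↦ μ(σ(a)/K(a,σ^ℓ(a)))` is nondecreasing for `ℓ ≥ 1`. -/
theorem stmt3 [Field U] [IsAlgClosed U] (σ : U ≃+* U) (K : Subfield U)
    (hK : K.map σ.toRingHom = K) {n : ℕ} (a : Fin n → U)
    (ha : ∀ i, IsAlgebraic (fAdj K (Set.range a)) (σ (a i)))
    (La : ℕ) (hLa : ∀ᶠ k in atTop, ldSeq σ K (Set.range a) k = La)
    (hmu : deg (fAdj K (Set.range a)) (⇑σ '' Set.range a) = La) :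
    ∀ ℓ : ℕ, 1 ≤ ℓ →
      deg (fAdj K (Set.range a ∪ ⇑(σ ^ ℓ) '' Set.range a)) (⇑σ '' Set.range a) ≤
      deg (fAdj K (Set.range a ∪ ⇑(σ ^ (ℓ + 1)) '' Set.range a)) (⇑σ '' Set.range a) := by
  intro ℓ hℓ
  set s := Set.range a
  have hd : 0 < deg (fAdj K s) (σ '' s) :=
    deg_pos_of_isAlgebraic _ ((Set.finite_range a).image σ) (by
      rintro _ ⟨_, ⟨i, rfl⟩, rfl⟩
      exact ha i)
  have hmem : ∀ i ≤ ℓ, ⇑(σ ^ i) '' s ⊆ ⋃ i ∈ Set.Iic ℓ, ⇑(σ ^ i) '' s := fun i hi ↦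
    Set.subset_biUnion_of_mem (u := fun i : ℕ ↦ ⇑(σ ^ i) '' s) (Set.mem_Iic.2 hi)
  have h0 : s ⊆ ⋃ i ∈ Set.Iic ℓ, ⇑(σ ^ i) '' s := by simpa using! hmem 0 (Nat.zero_le ℓ)
  have h1 : σ '' s ⊆ ⋃ i ∈ Set.Iic ℓ, ⇑(σ ^ i) '' s := by simpa using! hmem 1 hℓ
  have hsℓ := Set.union_subset h0 (hmem ℓ le_rfl)
  have key := deg_eq_limit σ K hK s La (hmu ▸ hd) hLa hmu ℓ
  have e₁ := key (fAdj K (s ∪ ⇑(σ ^ ℓ) '' s)) (fAdj_mono K Set.subset_union_right)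
    (fAdj_mono K hsℓ)
  have e₂ := key (fAdj K (s ∪ ⇑(σ ^ ℓ) '' s ∪ σ '' s))
    (fAdj_mono K (Set.subset_union_right.trans Set.subset_union_left))
    (fAdj_mono K (Set.union_subset hsℓ h1))
  have hcomm := deg_union (fAdj K (s ∪ ⇑(σ ^ ℓ) '' s)) (σ '' s) (⇑(σ ^ (ℓ + 1)) '' s)
  rw [Set.union_comm (σ '' s), deg_union, fAdj_fAdj, fAdj_fAdj, e₁, e₂, mul_comm] at hcomm
  rw [← Nat.eq_of_mul_eq_mul_right (hmu ▸ hd) hcomm]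
  refine deg_anti (fAdj_mono K ?_) (deg_pos_of_le (fAdj_mono K Set.subset_union_left) hd)
  exact Set.union_subset_union_left _ Set.subset_union_left
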